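/- arXiv:2010.10358 — 3 statements merged into one kernel-verified Lean document; each statement's English description precedes it below -/
import Mathlib

section
/- Let k > 2 be an integer and let A(z), B(z) be coprime real polynomials with A ≠ 0 and deg B ≥ 1. Define the polynomial sequence {P_n(z)} by the standard initial conditions P_0(z) = 1, P_{-1}(z) = ⋯ = P_{-k+1}(z) = 0 and the recurrence P_n(z) + B(z)P_{n-1}(z) + A(z)P_{n-k}(z) = 0 for all n ≥ 1. Then there exists an index n ≥ 1 and a complex number z with nonzero imaginary part such that P_n(z) = 0; that is, some polynomial in the sequence has a non-real zero. -/
open Polynomial Filter Topology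

/-- The polynomials `T q r` in one variable `v` such that the sequence with
`p n = b * p (n - 1) - a * p (n - k)` and `b ^ k = v * a` satisfies
`p (k * q + r) = b ^ r * a ^ q * (T q r)(v)` for `r < k`. -/
noncomputable def reducedPoly (k : ℕ) : ℕ → ℕ → ℂ[X]
  | 0, _ => 1
  | q + 1, 0 => X * reducedPoly k q (k - 1) - reducedPoly k q 0
  | q + 1, r + 1 => reducedPoly k (q + 1) r - reducedPoly k q (r + 1)
termination_by q r => (q, r)

theorem natDegree_reducedPoly_le (k q r : ℕ) : (reducedPoly k q r).natDegree ≤ q := by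
  induction q generalizing r with
  | zero => simp [reducedPoly]
  | succ q ihq =>
    induction r with
    | zero =>
      rw [reducedPoly]
      refine (natDegree_sub_le _ _).trans (max_le ?_ ((ihq 0).trans q.le_succ))
      refine natDegree_mul_le.trans ?_
      have := ihq (k - 1)
      rw [natDegree_X]
      omega
    | succ r ihr =>
      rw [reducedPoly]
      exact (natDegree_sub_le _ _).trans (max_le ihr ((ihq _).trans q.le_succ))

theorem coeff_zero_reducedPoly (k q r : ℕ) :
    (reducedPoly k q r).coeff 0 = (-1) ^ q * ((q + r).choose q : ℂ) := by
  induction q generalizing r with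
  | zero => simp [reducedPoly]
  | succ q ihq =>
    induction r with
    | zero =>
      rw [reducedPoly, coeff_sub, ihq]
      simp [pow_succ]
    | succ r ihr =>
      rw [reducedPoly, coeff_sub, ihr, ihq, show q + 1 + (r + 1) = (q + r + 1) + 1 by ring,
        Nat.choose_succ_succ (q + r + 1) q, show q + 1 + r = q + r + 1 by ring,
        show q + (r + 1) = q + r + 1 by ring]
      push_cast
      ring

theorem exists_coeff_one_reducedPoly_eq {k : ℕ} (hk : 2 ≤ k) (q : ℕ) :
    ∃ m : ℕ, (reducedPoly k q 0).coeff 1 = (-1) ^ (q + 1) * (m : ℂ) ∧ q * (q + 1) ≤ 2 * m := by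
  induction q with
  | zero => exact ⟨0, by simp [reducedPoly, coeff_one], by simp⟩
  | succ q ih =>
    obtain ⟨m, hm, hle⟩ := ih
    refine ⟨(q + (k - 1)).choose q + m, ?_, ?_⟩
    · rw [reducedPoly, coeff_sub, coeff_X_mul, coeff_zero_reducedPoly, hm]
      push_cast
      ring
    · have h : (q + 1).choose q ≤ (q + (k - 1)).choose q :=
        Nat.choose_le_choose q (by omega)
      rw [Nat.choose_succ_self_right] at h
      nlinarith

/-- A polynomial whose logarithmic derivative at `0` is large has a small root. -/
theorem exists_root_norm_lt_of_lt_norm_coeff_one {p : ℂ[X]} {ε : ℝ} (hε : 0 < ε)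
    (h0 : p.coeff 0 ≠ 0) (h : p.natDegree * ε⁻¹ < ‖p.coeff 1 / p.coeff 0‖) :
    ∃ v, p.eval v = 0 ∧ ‖v‖ < ε := by
  by_contra! hcon
  have hp : p ≠ 0 := by rintro rfl; simp at h0
  have key := (IsAlgClosed.splits p).eval_derivative_div_eval_of_ne_zero (x := 0)
    (by rwa [← coeff_zero_eq_eval_zero])
  rw [← coeff_zero_eq_eval_zero, ← coeff_zero_eq_eval_zero, coeff_derivative] at key
  simp only [zero_add, Nat.cast_zero, mul_one] at key
  rw [key] at h
  have hle := norm_multiset_sum_le (p.roots.map fun z => 1 / (0 - z))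
  rw [Multiset.map_map] at hle
  have hsum := Multiset.sum_le_card_nsmul
    (p.roots.map (norm ∘ fun z => 1 / (0 - z))) ε⁻¹ (by
      intro x hx
      obtain ⟨z, hz, rfl⟩ := Multiset.mem_map.1 hx
      have := hcon z ((mem_roots hp).1 hz)
      simpa using inv_anti₀ hε this)
  rw [Multiset.card_map, nsmul_eq_mul] at hsum
  have hcard : (p.roots.card : ℝ) * ε⁻¹ ≤ p.natDegree * ε⁻¹ := by
    gcongr
    exact p.card_roots'
  linarith

theorem exists_small_root_reducedPoly {k : ℕ} (hk : 2 ≤ k) {ε : ℝ} (hε : 0 < ε) :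
    ∃ q : ℕ, 1 ≤ q ∧ ∃ v : ℂ, v ≠ 0 ∧ ‖v‖ < ε ∧ (reducedPoly k q 0).eval v = 0 := by
  obtain ⟨q, hq⟩ := exists_nat_gt (2 * ε⁻¹)
  have hεi : 0 < ε⁻¹ := inv_pos.2 hε
  have hq0 : (0 : ℝ) < q := by linarith
  have hc0 : (reducedPoly k q 0).coeff 0 = (-1) ^ q := by simp [coeff_zero_reducedPoly]
  have hne : (reducedPoly k q 0).coeff 0 ≠ 0 := by simp [hc0]
  obtain ⟨m, hm, hle⟩ := exists_coeff_one_reducedPoly_eq hk q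
  have hle' : (q : ℝ) * (q + 1) ≤ 2 * m := by exact_mod_cast hle
  obtain ⟨v, hv, hvε⟩ := exists_root_norm_lt_of_lt_norm_coeff_one hε hne (by
    have hdeg : ((reducedPoly k q 0).natDegree : ℝ) ≤ q := by
      exact_mod_cast natDegree_reducedPoly_le k q 0
    calc ((reducedPoly k q 0).natDegree : ℝ) * ε⁻¹ ≤ q * ε⁻¹ := by gcongr
      _ < m := by nlinarith
      _ = _ := by rw [hm, hc0]; simp)
  refine ⟨q, by exact_mod_cast hq0, v, ?_, hvε, hv⟩
  rintro rfl
  exact hne (by rwa [coeff_zero_eq_eval_zero])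

theorem eq_reducedPoly_eval_of_recurrence {k : ℕ} (hk : 2 ≤ k) {a b v : ℂ} (hv : b ^ k = v * a)
    (p : ℤ → ℂ) (hp0 : p 0 = 1) (hpneg : ∀ i : ℤ, -(k : ℤ) + 1 ≤ i → i ≤ -1 → p i = 0)
    (hrec : ∀ n : ℤ, 1 ≤ n → p n = b * p (n - 1) - a * p (n - k)) (q r : ℕ) (hr : r < k) :
    p (k * q + r) = b ^ r * a ^ q * (reducedPoly k q r).eval v := by
  induction q generalizing r with
  | zero =>
    simp only [reducedPoly, Nat.cast_zero, mul_zero, zero_add, pow_zero, mul_one, eval_one]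
    induction r with
    | zero => simpa using hp0
    | succ r ih =>
      rw [hrec _ (by push_cast; omega), show ((r + 1 : ℕ) : ℤ) - 1 = r by push_cast; ring,
        hpneg ((r + 1 : ℕ) - k) (by push_cast; omega) (by push_cast; omega), ih (by omega)]
      ring
  | succ q ihq =>
    induction r with
    | zero =>
      have h1 : (k : ℤ) * (q + 1 : ℕ) + (0 : ℕ) - 1 = k * q + (k - 1 : ℕ) := by
        push_cast [Nat.cast_sub (show 1 ≤ k by omega)]; ring
      have h2 : (k : ℤ) * (q + 1 : ℕ) + (0 : ℕ) - k = k * q + (0 : ℕ) := by push_cast; ring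
      have h3 : (1 : ℤ) ≤ k * (q + 1 : ℕ) + (0 : ℕ) := by push_cast; nlinarith
      rw [hrec _ h3, h1, h2, ihq _ (by omega), ihq _ (by omega), reducedPoly, eval_sub, eval_mul,
        eval_X]
      have hb : b * b ^ (k - 1) = v * a := by rw [← pow_succ', Nat.sub_add_cancel (by omega), hv]
      linear_combination a ^ q * (reducedPoly k q (k - 1)).eval v * hb
    | succ r ihr =>
      have h1 : (k : ℤ) * (q + 1 : ℕ) + (r + 1 : ℕ) - 1 = k * (q + 1 : ℕ) + r := by
        push_cast; ring
      have h2 : (k : ℤ) * (q + 1 : ℕ) + (r + 1 : ℕ) - k = k * q + (r + 1 : ℕ) := by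
        push_cast; ring
      have h3 : (1 : ℤ) ≤ k * (q + 1 : ℕ) + (r + 1 : ℕ) := by push_cast; nlinarith
      rw [hrec _ h3, h1, h2, ihr (by omega), ihq _ hr, reducedPoly, eval_sub]
      ring

theorem exists_pow_eq_and_im_ne_zero {k : ℕ} (hk : 2 < k) {c : ℂ} (hc : c ≠ 0) :
    ∃ w : ℂ, w ^ k = c ∧ w.im ≠ 0 := by
  obtain ⟨w, hw⟩ := IsAlgClosed.exists_pow_nat_eq c (show 0 < k by omega)
  by_cases him : w.im = 0
  · have hζ := Complex.isPrimitiveRoot_exp k (by omega)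
    set ζ := Complex.exp (2 * Real.pi * Complex.I / k)
    refine ⟨ζ * w, by rw [mul_pow, hζ.pow_eq_one, one_mul, hw], fun h => ?_⟩
    have hwre : w.re ≠ 0 := by
      intro hre
      have : w = 0 := Complex.ext hre him
      exact hc (by rw [← hw, this, zero_pow (by omega)])
    have hζim : ζ.im = 0 := by
      rw [Complex.mul_im, him, mul_zero, zero_add] at h
      exact (mul_eq_zero.1 h).resolve_right hwre
    have hζre : ζ = (ζ.re : ℂ) := Complex.ext rfl (by simp [hζim])
    have hnorm : ‖ζ‖ = 1 := hζ.norm'_eq_one (by omega)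
    have hsq : ζ ^ 2 = 1 := by
      rw [hζre, Complex.norm_real, Real.norm_eq_abs] at hnorm
      rw [hζre]
      exact_mod_cast (by rw [← sq_abs, hnorm, one_pow] : ζ.re ^ 2 = 1)
    exact absurd (Nat.le_of_dvd (by norm_num) (hζ.dvd_of_pow_eq_one 2 hsq)) (by omega)
  · exact ⟨w, hw, him⟩

theorem aeval_eq_ofReal_of_im_eq_zero (p : ℝ[X]) {z : ℂ} (hz : z.im = 0) :
    aeval z p = ((p.eval z.re : ℝ) : ℂ) := by
  have : z = algebraMap ℝ ℂ z.re := Complex.ext rfl (by simp [hz])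
  conv_lhs => rw [this]
  rw [aeval_algebraMap_apply_eq_algebraMap_eval]
  rfl

/-- Near a real zero of `B` where `A` does not vanish, `(-B) ^ k / A` takes every small nonzero
value at a non-real point. -/
theorem exists_nonreal_pow_eq_mul {k : ℕ} (hk : 2 < k) {A B : ℝ[X]} (hB : B ≠ 0) {x : ℝ}
    (hBx : B.eval x = 0) (hAx : A.eval x ≠ 0) :
    ∃ ε > 0, ∀ v : ℂ, v ≠ 0 → ‖v‖ < ε →
      ∃ z : ℂ, z.im ≠ 0 ∧ (-aeval z B) ^ k = v * aeval z A := by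
  have hk0 : k ≠ 0 := by omega
  obtain ⟨s, hs, hsA⟩ : ∃ s : ℝ, s ^ 2 = 1 ∧ 0 < s * A.eval x := by
    rcases hAx.lt_or_gt with h | h
    · exact ⟨-1, by norm_num, by linarith⟩
    · exact ⟨1, by norm_num, by linarith⟩
  have hsC : (s : ℂ) ^ 2 = 1 := by exact_mod_cast hs
  have hs0 : (s : ℂ) ≠ 0 := by rintro h; simp [h] at hsC
  let F : ℂ → ℂ := fun z => s * aeval z A
  let α : ℂ → ℂ := fun z => F z ^ ((k : ℂ)⁻¹)
  let g : ℂ → ℂ := fun z => -aeval z B / α z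
  have hαpow (z : ℂ) : α z ^ k = F z := Complex.cpow_nat_inv_pow _ hk0
  have hFx : F x = ((s * A.eval x : ℝ) : ℂ) := by
    simp [F, aeval_eq_ofReal_of_im_eq_zero A (Complex.ofReal_im x)]
  have hBx' : aeval (x : ℂ) B = 0 := by
    simp [aeval_eq_ofReal_of_im_eq_zero B (Complex.ofReal_im x), hBx]
  have hα0 {z : ℂ} (hz : 0 < (F z).re) : α z ≠ 0 := by
    intro h
    have := hαpow z
    rw [h, zero_pow hk0] at this
    simp [← this] at hz
  have hFx_pos : 0 < (F x).re := by rw [hFx]; exact hsA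
  have hFan : AnalyticAt ℂ F x := analyticAt_const.mul (analyticAt_id.aeval_polynomial A)
  have hgan : AnalyticAt ℂ g x :=
    (analyticAt_id.aeval_polynomial B).neg.div
      (hFan.cpow analyticAt_const (Or.inl hFx_pos)) (hα0 hFx_pos)
  have hgx : g x = 0 := by simp [g, hBx']
  have hU : ∀ᶠ z in 𝓝 (x : ℂ), 0 < (F z).re :=
    (Complex.continuous_re.continuousAt.comp hFan.continuousAt).eventually_const_lt hFx_pos
  have hopen : 𝓝 (g x) ≤ map g (𝓝 (x : ℂ)) := by
    refine hgan.eventually_constant_or_nhds_le_map_nhds.resolve_left fun hconst => ?_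
    have hroots : ∀ᶠ z in 𝓝 (x : ℂ), z ∈ B.rootSet ℂ := by
      filter_upwards [hconst, hU] with z hz hzU
      rw [hgx, div_eq_zero_iff, neg_eq_zero, or_iff_left (hα0 hzU)] at hz
      exact mem_rootSet.2 ⟨hB, hz⟩
    exact (infinite_of_mem_nhds (x : ℂ) hroots) (rootSet_finite _ ℂ)
  rw [hgx] at hopen
  obtain ⟨δ, hδ, hball⟩ := Metric.mem_nhds_iff.1 (hopen (image_mem_map hU))
  refine ⟨δ ^ k, pow_pos hδ k, fun v hv hvδ => ?_⟩
  obtain ⟨w, hw, hwim⟩ := exists_pow_eq_and_im_ne_zero hk (mul_ne_zero hs0 hv)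
  have hsnorm : ‖(s : ℂ)‖ = 1 := by
    have := congrArg norm hsC
    rw [norm_pow, norm_one] at this
    exact (pow_eq_one_iff_of_nonneg (norm_nonneg _) two_ne_zero).1 this
  have hwδ : ‖w‖ < δ := by
    refine lt_of_pow_lt_pow_left₀ k hδ.le ?_
    rwa [← norm_pow, hw, norm_mul, hsnorm, one_mul]
  obtain ⟨z, hzU, hzw⟩ := hball (mem_ball_zero_iff.2 hwδ)
  have hzU : 0 < (F z).re := hzU
  refine ⟨z, fun hz => hwim ?_, ?_⟩
  · have hFz : F z = ((s * A.eval z.re : ℝ) : ℂ) := by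
      simp [F, aeval_eq_ofReal_of_im_eq_zero A hz]
    have hpos : 0 < s * A.eval z.re := by rwa [hFz] at hzU
    have hαz : α z = (((s * A.eval z.re) ^ ((k : ℝ)⁻¹) : ℝ) : ℂ) := by
      rw [Complex.ofReal_cpow hpos.le, ← hFz]
      simp [α]
    rw [← hzw]
    simp only [g]
    rw [hαz, aeval_eq_ofReal_of_im_eq_zero B hz, ← Complex.ofReal_neg, ← Complex.ofReal_div,
      Complex.ofReal_im]
  · have hB' : -aeval z B = w * α z := by rw [← hzw]; exact (div_mul_cancel₀ _ (hα0 hzU)).symm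
    rw [hB', mul_pow, hw, hαpow]
    linear_combination v * aeval z A * hsC


/-- For an integer `k > 2` and coprime real polynomials `A ≠ 0`, `B` with
`deg B ≥ 1`, the sequence generated by `P n + B * P (n-1) + A * P (n-k) = 0` with the
standard initial conditions always contains a polynomial with a non-real zero. -/
theorem stmt_0 (k : ℕ) (hk : 2 < k) (A B : Polynomial ℝ)
    (hA : A ≠ 0) (hB : 1 ≤ B.natDegree)
    (hcop : ∀ z : ℂ, ¬(Polynomial.aeval z A = 0 ∧ Polynomial.aeval z B = 0))
    (P : ℤ → Polynomial ℝ)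
    (hP0 : P 0 = 1)
    (hPneg : ∀ i : ℤ, -(k : ℤ) + 1 ≤ i → i ≤ -1 → P i = 0)
    (hrec : ∀ n : ℤ, 1 ≤ n → P n + B * P (n - 1) + A * P (n - (k : ℤ)) = 0) :
    ∃ n : ℤ, 1 ≤ n ∧ ∃ z : ℂ, z.im ≠ 0 ∧ Polynomial.aeval z (P n) = 0 := by
  have hB0 : B ≠ 0 := by rintro rfl; simp at hB
  obtain ⟨z₀, hz₀⟩ : ∃ z₀ : ℂ, aeval z₀ B = 0 := by
    refine IsAlgClosed.exists_aeval_eq_zero ℂ B fun h => ?_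
    have := natDegree_eq_zero_iff_degree_le_zero.2 h.le
    omega
  by_cases him : z₀.im = 0
  · have hreal : (z₀.re : ℂ) = z₀ := Complex.ext rfl (by simp [him])
    have hBx : B.eval z₀.re = 0 := by
      have h := aeval_eq_ofReal_of_im_eq_zero B him
      rw [hz₀] at h
      exact_mod_cast h.symm
    have hAx : A.eval z₀.re ≠ 0 := by
      intro h
      refine hcop z₀ ⟨?_, hz₀⟩
      rw [aeval_eq_ofReal_of_im_eq_zero A him, h, Complex.ofReal_zero]
    obtain ⟨ε, hε, hex⟩ := exists_nonreal_pow_eq_mul hk hB0 hBx hAx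
    obtain ⟨q, hq, v, hv, hvε, hroot⟩ := exists_small_root_reducedPoly hk.le hε
    obtain ⟨z, hz, hpow⟩ := hex v hv hvε
    refine ⟨k * q + (0 : ℕ), ?_, z, hz, ?_⟩
    · have : 1 ≤ k * q := Nat.mul_pos (by omega) hq
      push_cast
      exact_mod_cast this
    · rw [eq_reducedPoly_eval_of_recurrence hk.le hpow (fun n => aeval z (P n)) (by simp [hP0])
        (fun i h1 h2 => by simp [hPneg i h1 h2]) (fun n hn => ?_) q 0 (by omega), hroot, mul_zero]
      have := congrArg (aeval z) (hrec n hn)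
      simp only [map_add, map_mul, map_zero] at this
      linear_combination this
  · refine ⟨1, le_rfl, z₀, him, ?_⟩
    have h := congrArg (aeval z₀) (hrec 1 le_rfl)
    rw [hPneg (1 - k) (by omega) (by omega)] at h
    simpa [hP0, hz₀] using h
end

section
/- Let k > ℓ ≥ 1 be coprime integers and let a, b, c be complex numbers with a ≠ 0. Let r_1, …, r_k be the complex roots (listed with multiplicity) of the trinomial P(x) = a·x^k + b·x^ℓ + c. Then the discriminant satisfies a^{2k-2} · ∏_{1 ≤ i < j ≤ k} (r_i − r_j)^2 = (−1)^{k(k−1)/2} · ( k^k · c^{k−1} · a^{k−1} + (−1)^{k−1} · ℓ^ℓ · (k−ℓ)^{k−ℓ} · c^{ℓ−1} · b^k · a^{k−ℓ−1} ). -/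
open Finset Polynomial in
/-- The coprime power map permutes the `m`-th roots of unity. -/
theorem prod_nthRootsFinset_pow_of_coprime {K M : Type*} [Field K] [CommMonoid M] {m l : ℕ}
    (hm : 0 < m) (hlm : Nat.Coprime l m) (f : K → M) :
    ∏ ζ ∈ nthRootsFinset m (1 : K), f (ζ ^ l) = ∏ ζ ∈ nthRootsFinset m (1 : K), f ζ := by
  have hmaps : Set.MapsTo (fun ζ : K => ζ ^ l) (nthRootsFinset m (1 : K))
      (nthRootsFinset m (1 : K)) := by
    intro ζ hζ
    simp only [SetLike.mem_coe, mem_nthRootsFinset hm] at hζ ⊢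
    rw [pow_right_comm, hζ, one_pow]
  have hinj : Set.InjOn (fun ζ : K => ζ ^ l) (nthRootsFinset m (1 : K)) := by
    intro ζ hζ ξ hξ h
    simp only [SetLike.mem_coe, mem_nthRootsFinset hm] at hζ hξ h
    have hξ0 : ξ ≠ 0 := by
      rintro rfl
      simp [hm.ne'] at hξ
    have h1 : (ζ / ξ) ^ l = 1 := by rw [div_pow, h, div_self (pow_ne_zero _ hξ0)]
    have h2 : (ζ / ξ) ^ m = 1 := by rw [div_pow, hζ, hξ, div_one]
    have h3 := pow_gcd_eq_one.2 ⟨h1, h2⟩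
    rw [hlm.gcd_eq_one, pow_one] at h3
    exact (div_eq_one_iff_eq hξ0).1 h3
  exact prod_nbij (fun ζ => ζ ^ l) hmaps hinj
    (surjOn_of_injOn_of_card_le _ hmaps hinj le_rfl) fun _ _ => rfl

open Finset in
/-- The off-diagonal product of root differences is the product of their squares over ordered
pairs, up to sign. -/
theorem prod_prod_compl_sub_eq {R : Type*} [CommRing R] (k : ℕ) (r : Fin k → R) :
    ∏ i, ∏ j ∈ {i}ᶜ, (r i - r j) =
      (-1) ^ (k * (k - 1) / 2) * ∏ i, ∏ j ∈ univ.filter (fun j => i < j), (r i - r j) ^ 2 := by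
  have hcard : ∑ i : Fin k, #(Ioi i) = k * (k - 1) / 2 := by
    simp_rw [Fin.card_Ioi]
    rw [Fin.sum_univ_eq_sum_range (fun i => k - 1 - i) k, sum_range_reflect (fun i => i) k,
      sum_range_id]
  have hfilter : ∀ i : Fin k, univ.filter (fun j => i < j) = Ioi i := by
    intro i
    ext j
    simp
  simp_rw [hfilter]
  rw [← prod_prod_Ioi_mul_eq_prod_prod_off_diag (fun j i => r i - r j), ← hcard,
    ← prod_pow_eq_pow_sum, ← prod_mul_distrib]
  refine prod_congr rfl fun i _ => ?_
  rw [← prod_const, ← prod_mul_distrib]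
  exact prod_congr rfl fun j _ => by ring

open Finset Polynomial in
/-- The derivative of a product of linear factors, evaluated at one of its roots. -/
theorem eval_derivative_prod_X_sub_C {R ι : Type*} [CommRing R] [Fintype ι] [DecidableEq ι]
    (r : ι → R) (i : ι) :
    (derivative (∏ j, (X - C (r j)))).eval (r i) = ∏ j ∈ {i}ᶜ, (r i - r j) := by
  rw [derivative_prod_finset, eval_finsetSum, sum_eq_single i]
  · rw [compl_eq_univ_sdiff, sdiff_singleton_eq_erase]
    simp [eval_prod]
  · intro j _ hji
    rw [eval_mul, eval_prod, prod_eq_zero (mem_erase.2 ⟨hji.symm, mem_univ i⟩) (by simp), zero_mul]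
  · simp

open Finset Polynomial in
/-- If `r` lists the roots of `a x ^ (l + m) + b x ^ l + c`, this is the product over the roots of
the nontrivial factor of the derivative. -/
theorem prod_trinomial_derivative_factor {l m : ℕ} (hm : 0 < m) (hlm : Nat.Coprime l m)
    {a b c : ℂ} (ha : a ≠ 0) (r : Fin (l + m) → ℂ)
    (hP : ∀ z : ℂ, a * z ^ (l + m) + b * z ^ l + c = a * ∏ i, (z - r i)) :
    ∏ i, (((l + m : ℕ) : ℂ) * a * r i ^ m + b * l) =
      (-1) ^ ((l + m) * m) * (((l + m : ℕ) : ℂ) ^ (l + m) * a ^ l * c ^ m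
        - (-1) ^ (l + m) * b ^ (l + m) * (m : ℂ) ^ m * (l : ℂ) ^ l) := by
  set κ : ℂ := ((l + m : ℕ) : ℂ) with hκ
  have hκ0 : κ ≠ 0 := Nat.cast_ne_zero.2 (by omega)
  have hκe : κ = l + m := by rw [hκ]; push_cast; rfl
  obtain ⟨z, hz⟩ := IsAlgClosed.exists_pow_nat_eq (-(b * l) / (κ * a)) hm
  have hω := Complex.isPrimitiveRoot_exp m hm.ne'
  have hfac : ∀ x : ℂ, κ * a * x ^ m + b * l =
      κ * a * ∏ ζ ∈ nthRootsFinset m (1 : ℂ), (x - ζ * z) := by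
    intro x
    rw [← hω.pow_sub_pow_eq_prod_sub_mul _ _ hm, hz]
    field_simp
    ring
  have heval : ∀ ζ ∈ nthRootsFinset m (1 : ℂ), ∏ i, (r i - ζ * z) =
      (-1) ^ (l + m) / a * (c - ζ ^ l * (-(b * m / κ) * z ^ l)) := by
    intro ζ hζ
    have hζ' := (mem_nthRootsFinset hm 1).1 hζ
    have h1 : ∏ i, (r i - ζ * z) = (-1) ^ (l + m) * ∏ i, (ζ * z - r i) := by
      rw [← Fin.prod_const, ← prod_mul_distrib]
      exact prod_congr rfl fun i _ => by ring
    have h2 := hP (ζ * z)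
    have h3 : a * (ζ * z) ^ (l + m) + b * (ζ * z) ^ l = ζ ^ l * (b * m / κ * z ^ l) := by
      rw [pow_add, mul_pow ζ z m, hζ', hz, mul_pow]
      field_simp
      rw [hκe]
      ring
    rw [h3] at h2
    rw [h1, div_mul_eq_mul_div, eq_div_iff ha]
    linear_combination (-(-1) ^ (l + m)) * h2
  simp_rw [hfac]
  rw [prod_mul_distrib, prod_const, prod_comm, prod_congr rfl heval, prod_mul_distrib,
    prod_nthRootsFinset_pow_of_coprime hm hlm (fun ζ => c - ζ * (-(b * m / κ) * z ^ l)),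
    ← hω.pow_sub_pow_eq_prod_sub_mul _ _ hm, prod_const, hω.card_nthRootsFinset,
    mul_pow (-(b * m / κ)), ← pow_mul z, mul_comm l m, pow_mul z, hz, card_univ, Fintype.card_fin]
  rw [neg_pow (b * m / κ), neg_div, neg_pow (b * l / (κ * a)), div_pow, div_pow, div_pow, ← pow_mul,
    pow_add (κ * a)]
  simp only [mul_pow]
  field_simp
  ring

/-- discriminant of the trinomial `a*x^k + b*x^ℓ + c` for coprime
`k > ℓ ≥ 1`, in terms of its roots `r 0, …, r (k-1)` listed with multiplicity. -/
theorem stmt_5 (k l : ℕ) (hl : 1 ≤ l) (hlk : l < k) (hcop : Nat.Coprime k l)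
    (a b c : ℂ) (ha : a ≠ 0) (r : Fin k → ℂ)
    (hroots : Polynomial.C a * Polynomial.X ^ k + Polynomial.C b * Polynomial.X ^ l
        + Polynomial.C c = Polynomial.C a * ∏ i, (Polynomial.X - Polynomial.C (r i))) :
    a ^ (2 * k - 2) *
        ∏ i, ∏ j ∈ Finset.univ.filter (fun j => i < j), (r i - r j) ^ 2
      = (-1) ^ (k * (k - 1) / 2) *
        ((k : ℂ) ^ k * c ^ (k - 1) * a ^ (k - 1)
          + (-1) ^ (k - 1) * (l : ℂ) ^ l * ((k - l : ℕ) : ℂ) ^ (k - l)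
            * c ^ (l - 1) * b ^ k * a ^ (k - l - 1)) := by
  obtain ⟨n, rfl⟩ : ∃ n, l = n + 1 := ⟨l - 1, by omega⟩
  obtain ⟨p, rfl⟩ : ∃ p, k = n + 1 + (p + 1) := ⟨k - (n + 1) - 1, by omega⟩
  have hlm : Nat.Coprime (n + 1) (p + 1) := by
    rw [Nat.coprime_comm]
    simpa using hcop
  have hP : ∀ z : ℂ, a * z ^ (n + 1 + (p + 1)) + b * z ^ (n + 1) + c = a * ∏ i, (z - r i) := by
    intro z
    simpa [Polynomial.eval_prod] using congrArg (Polynomial.eval z) hroots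
  have hder : ∀ i, a * ∏ j ∈ {i}ᶜ, (r i - r j) =
      r i ^ n * (((n + 1 + (p + 1) : ℕ) : ℂ) * a * r i ^ (p + 1) + b * (n + 1 : ℕ)) := by
    intro i
    have h := congrArg (fun q => (Polynomial.derivative q).eval (r i)) hroots
    simp only [Polynomial.derivative_C_mul, Polynomial.eval_mul, Polynomial.eval_C,
      eval_derivative_prod_X_sub_C] at h
    rw [← h, Polynomial.derivative_add, Polynomial.derivative_add, Polynomial.derivative_C_mul,
      Polynomial.derivative_C_mul, Polynomial.derivative_X_pow, Polynomial.derivative_X_pow,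
      Polynomial.derivative_C, show n + 1 + (p + 1) - 1 = n + (p + 1) by omega,
      Nat.add_sub_cancel]
    simp only [Polynomial.eval_add, Polynomial.eval_mul, Polynomial.eval_C, Polynomial.eval_pow,
      Polynomial.eval_X, Polynomial.eval_zero]
    ring
  have hprod : a * ∏ i, r i = (-1) ^ (n + 1 + (p + 1)) * c := by
    have h0 := hP 0
    simp only [zero_sub, Finset.prod_neg, Finset.card_univ, Fintype.card_fin] at h0
    have hs : ((-1 : ℂ) ^ (n + 1 + (p + 1))) * (-1) ^ (n + 1 + (p + 1)) = 1 := by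
      rw [← mul_pow]; simp
    simp at h0
    rw [h0]
    linear_combination (-(a * ∏ i, r i)) * hs
  have hall := Finset.prod_congr (rfl : (Finset.univ : Finset (Fin (n + 1 + (p + 1)))) = _)
    fun i _ => hder i
  rw [Finset.prod_mul_distrib, Finset.prod_mul_distrib, Finset.prod_pow,
    prod_trinomial_derivative_factor (by omega) hlm ha r hP, prod_prod_compl_sub_eq,
    Finset.prod_const, Finset.card_univ, Fintype.card_fin] at hall
  have hsign : ((-1 : ℂ) ^ (n + 1 + (p + 1))) ^ n * (-1) ^ ((n + 1 + (p + 1)) * (p + 1)) = 1 := by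
    rw [← pow_mul, ← pow_add]
    refine Even.neg_one_pow ?_
    convert Nat.even_mul_succ_self (n + (p + 1)) using 1
    ring
  have hpow : a ^ n * (∏ i, r i) ^ n = ((-1) ^ (n + 1 + (p + 1))) ^ n * c ^ n := by
    rw [← mul_pow, hprod, mul_pow]
  rw [show 2 * (n + 1 + (p + 1)) - 2 = (n + p) + (n + 1 + (p + 1)) by omega,
    show n + 1 + (p + 1) - 1 = n + p + 1 by omega, show n + 1 + (p + 1) - (n + 1) = p + 1 by omega,
    Nat.add_sub_cancel, Nat.add_sub_cancel]
  rw [show n + 1 + (p + 1) - 1 = n + p + 1 by omega] at hall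
  set s := (n + 1 + (p + 1)) * (n + p + 1) / 2
  set D := ∏ i, ∏ j ∈ Finset.univ.filter (fun j => i < j), (r i - r j) ^ 2
  set R := ∏ i, r i
  set κ : ℂ := ((n + 1 + (p + 1) : ℕ) : ℂ)
  set F := κ ^ (n + 1 + (p + 1)) * a ^ (n + 1) * c ^ (p + 1)
    - (-1) ^ (n + 1 + (p + 1)) * b ^ (n + 1 + (p + 1)) * ((p + 1 : ℕ) : ℂ) ^ (p + 1)
      * ((n + 1 : ℕ) : ℂ) ^ (n + 1) with hF
  have hs : ((-1 : ℂ) ^ s) * (-1) ^ s = 1 := by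
    rw [← mul_pow]
    simp
  calc a ^ (n + p + (n + 1 + (p + 1))) * D
      = ((-1) ^ s * (-1) ^ s) * (a ^ (n + p + (n + 1 + (p + 1))) * D) := by rw [hs, one_mul]
    _ = (-1) ^ s * a ^ (n + p) * (a ^ (n + 1 + (p + 1)) * ((-1) ^ s * D)) := by ring
    _ = (-1) ^ s * a ^ p * (a ^ n * R ^ n) * ((-1) ^ ((n + 1 + (p + 1)) * (p + 1)) * F) := by
      rw [hall]
      ring
    _ = (-1) ^ s * a ^ p * c ^ n * F *
        (((-1) ^ (n + 1 + (p + 1))) ^ n * (-1) ^ ((n + 1 + (p + 1)) * (p + 1))) := by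
      rw [hpow]
      ring
    _ = _ := by
      rw [hsign, hF]
      ring
end

section
/- Let k ≥ 2 be an integer and let a, b be complex numbers with a ≠ 0. The polynomial t^k + b·t + a has a repeated complex root if and only if k^k · a^{k−1} + (−1)^{k−1} · (k−1)^{k−1} · b^k = 0. -/
open Polynomial in
/-- The square of `X - C t` divides a nonzero polynomial iff `t` is a common root of the polynomial
and its derivative. -/
theorem X_sub_C_sq_dvd_iff {R : Type*} [CommRing R] {p : R[X]} (hp : p ≠ 0) (t : R) :
    (X - C t) ^ 2 ∣ p ↔ p.IsRoot t ∧ (derivative p).IsRoot t := by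
  rw [← le_rootMultiplicity_iff hp, ← one_lt_rootMultiplicity_iff_isRoot hp]
  rfl

/-- A trinomial `t ^ (n + 1) + b * t + a` and its derivative have a common root iff its
discriminant vanishes. -/
theorem exists_common_root_trinomial_iff {K : Type*} [Field K] [CharZero K] {n : ℕ} (hn : n ≠ 0)
    {a : K} (b : K) (ha : a ≠ 0) :
    (∃ t : K, t ^ (n + 1) + b * t + a = 0 ∧ ((n : K) + 1) * t ^ n + b = 0) ↔
      ((n : K) + 1) ^ (n + 1) * a ^ n + (-1) ^ n * (n : K) ^ n * b ^ (n + 1) = 0 := by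
  have hn0 : (n : K) ≠ 0 := Nat.cast_ne_zero.mpr hn
  have hn1 : (n : K) + 1 ≠ 0 := Nat.cast_add_one_ne_zero n
  have hs : ((-1 : K) ^ n) * (-1) ^ n = 1 := by rw [← mul_pow]; simp
  constructor
  · rintro ⟨t, h, h'⟩
    have hb : b = -1 * (((n : K) + 1) * t ^ n) := by linear_combination h'
    have ha' : a = n * (t * t ^ n) := by rw [hb] at h; linear_combination h
    rw [ha', hb]
    simp only [mul_pow, pow_succ]
    linear_combination (-((n : K) + 1) ^ n * (n + 1) * n ^ n * (t ^ n) ^ n * t ^ n) * hs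
  · intro h
    have hb : b ≠ 0 := by
      rintro rfl
      simp [hn1, ha] at h
    have ht : ((n : K) + 1) * (-1 * (((n : K) + 1) * a) / (n * b)) ^ n + b = 0 := by
      rw [div_pow, mul_pow, mul_pow, mul_pow]
      field_simp
      linear_combination (-1) ^ n * h - n ^ n * b ^ (n + 1) * hs
    refine ⟨_, ?_, ht⟩
    set t := -1 * (((n : K) + 1) * a) / (n * b) with ht_def
    have hta : t * (n * b) = -1 * (((n : K) + 1) * a) := by rw [ht_def]; field_simp
    apply mul_left_cancel₀ hn1
    linear_combination t * ht + hta

/-- for `k ≥ 2` and complex `a ≠ 0`, `b`, the polynomial `t^k + b*t + a`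
has a repeated complex root iff `k^k * a^(k-1) + (-1)^(k-1) * (k-1)^(k-1) * b^k = 0`. -/
theorem stmt_7 (k : ℕ) (hk : 2 ≤ k) (a b : ℂ) (ha : a ≠ 0) :
    (∃ t0 : ℂ, (Polynomial.X - Polynomial.C t0) ^ 2 ∣
        (Polynomial.X ^ k + Polynomial.C b * Polynomial.X + Polynomial.C a)) ↔
      (k : ℂ) ^ k * a ^ (k - 1) + (-1) ^ (k - 1) * ((k - 1 : ℕ) : ℂ) ^ (k - 1) * b ^ k = 0 := by
  obtain ⟨n, rfl⟩ : ∃ n, k = n + 1 := ⟨k - 1, by omega⟩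
  have hp : (Polynomial.X ^ (n + 1) + Polynomial.C b * Polynomial.X + Polynomial.C a) ≠ 0 := by
    intro h
    apply ha
    simpa using congrArg (Polynomial.eval 0) h
  have key := exists_common_root_trinomial_iff (n := n) (by omega) b ha
  simp only [X_sub_C_sq_dvd_iff hp]
  simpa using key
end
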